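/- arXiv:math/0611790 — 6 statements merged into one kernel-verified Lean document; each statement's English description precedes it below -/
import Mathlib

section
/- Let K be a field and R = K[x1,…,x5] the polynomial ring in five variables over K, and let I be the ideal of R generated by the monomials x1x3, x1x4, x2x4, x2x5, x3x5. Then I equals the radical of the ideal generated by the three polynomials x1x3, x1x4 + x2x5, x2x4 + x3x5. -/
open MvPolynomial

lemma aux_dom {A : Type*} [CommRing A] [IsDomain A] (a b c d e : A)
    (h : (a = 0 ∨ c = 0) ∧ a * d + b * e = 0 ∧ b * d + c * e = 0) :
    (a = 0 ∨ c = 0) ∧ (a = 0 ∨ d = 0) ∧ (b = 0 ∨ d = 0) ∧ (b = 0 ∨ e = 0) ∧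
      (c = 0 ∨ e = 0) := by
  obtain ⟨rfl | rfl, h1, h2⟩ := h
  · have : b = 0 ∨ e = 0 := by simpa using h1
    rcases this with rfl | rfl <;> simp_all
  · have : b = 0 ∨ d = 0 := by simpa using h2
    rcases this with rfl | rfl <;> simp_all

lemma aux_dvd {K : Type*} [Field K] (i j : Fin 5) (hij : i ≠ j) (m : Fin 5 →₀ ℕ) (c : K)
    (hi : m i ≠ 0) (hj : m j ≠ 0) :
    (X i * X j : MvPolynomial (Fin 5) K) ∣ monomial m c := by
  have h : (X i * X j : MvPolynomial (Fin 5) K)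
      = monomial (Finsupp.single i 1 + Finsupp.single j 1) 1 := by
    simp [X, monomial_mul]
  rw [h, monomial_dvd_monomial]
  refine ⟨Or.inr ?_, one_dvd _⟩
  intro k
  simp only [Finsupp.add_apply, Finsupp.single_apply]
  split_ifs <;> grind

open Classical in
/-- Kill the variables outside the support of `m`. -/
noncomputable def killHom (K : Type*) [Field K] (m : Fin 5 →₀ ℕ) :
    MvPolynomial (Fin 5) K →ₐ[K] MvPolynomial (Fin 5) K :=
  aeval (fun i => if m i = 0 then 0 else X i)

lemma killHom_coeff {K : Type*} [Field K] (m : Fin 5 →₀ ℕ) (f : MvPolynomial (Fin 5) K)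
    (hf : killHom K m f = 0) : coeff m f = 0 := by
  have key : f - killHom K m f ∈
      Ideal.span (X '' {i | m i = 0} : Set (MvPolynomial (Fin 5) K)) := by
    rw [← Ideal.Quotient.eq]
    have : (Ideal.Quotient.mkₐ K (Ideal.span (X '' {i | m i = 0} :
        Set (MvPolynomial (Fin 5) K)))) = (Ideal.Quotient.mkₐ K _).comp (killHom K m) := by
      apply MvPolynomial.algHom_ext
      intro i
      by_cases h : m i = 0
      · simp only [AlgHom.comp_apply, killHom, aeval_X, h, if_true, map_zero]
        exact Ideal.Quotient.eq_zero_iff_mem.2 (Ideal.subset_span ⟨i, h, rfl⟩)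
      · simp [killHom, h]
    exact congrArg (fun g => g f) this
  rw [hf, sub_zero, mem_ideal_span_X_image] at key
  by_contra h
  obtain ⟨i, hi, hi'⟩ := key m (mem_support_iff.2 h)
  exact hi' hi


/-- **Example 2 (Barile).** In `R = K[x₁,…,x₅]`, the ideal
`I = (x₁x₃, x₁x₄, x₂x₄, x₂x₅, x₃x₅)` satisfies
`I = √(x₁x₃, x₁x₄ + x₂x₅, x₂x₄ + x₃x₅)`.
(The variables `x₁,…,x₅` are `X 0, …, X 4`.) -/
theorem pentagon_eq_radical_three (K : Type*) [Field K] :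
    Ideal.span ({X 0 * X 2, X 0 * X 3, X 1 * X 3, X 1 * X 4, X 2 * X 4} :
        Set (MvPolynomial (Fin 5) K)) =
      (Ideal.span ({X 0 * X 2, X 0 * X 3 + X 1 * X 4, X 1 * X 3 + X 2 * X 4} :
        Set (MvPolynomial (Fin 5) K))).radical := by
  apply le_antisymm
  · rw [Ideal.radical_eq_sInf]
    refine le_sInf ?_
    rintro P ⟨hJ, hP⟩
    rw [Ideal.span_le] at hJ ⊢
    simp only [Set.insert_subset_iff, Set.singleton_subset_iff, SetLike.mem_coe] at hJ ⊢
    simp only [← Ideal.Quotient.eq_zero_iff_mem, map_add, map_mul, mul_eq_zero] at hJ ⊢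
    exact aux_dom _ _ _ _ _ hJ
  · intro f hf
    have hJI : Ideal.span ({X 0 * X 2, X 0 * X 3 + X 1 * X 4, X 1 * X 3 + X 2 * X 4} :
        Set (MvPolynomial (Fin 5) K)) ≤ Ideal.span ({X 0 * X 2, X 0 * X 3, X 1 * X 3,
          X 1 * X 4, X 2 * X 4} : Set (MvPolynomial (Fin 5) K)) := by
      rw [Ideal.span_le]
      simp only [Set.insert_subset_iff, Set.singleton_subset_iff, SetLike.mem_coe]
      refine ⟨Ideal.subset_span (by simp), Ideal.add_mem _ (Ideal.subset_span (by simp))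
        (Ideal.subset_span (by simp)), Ideal.add_mem _ (Ideal.subset_span (by simp))
        (Ideal.subset_span (by simp))⟩
    obtain ⟨n, hn⟩ := hf
    rw [f.as_sum]
    refine Ideal.sum_mem _ fun m hm => ?_
    have gen : ∀ i j : Fin 5, i ≠ j → (X i * X j : MvPolynomial (Fin 5) K) ∈
        ({X 0 * X 2, X 0 * X 3, X 1 * X 3, X 1 * X 4, X 2 * X 4} :
          Set (MvPolynomial (Fin 5) K)) → m i ≠ 0 → m j ≠ 0 →
        monomial m (coeff m f) ∈ Ideal.span ({X 0 * X 2, X 0 * X 3, X 1 * X 3, X 1 * X 4,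
          X 2 * X 4} : Set (MvPolynomial (Fin 5) K)) := fun i j hij hmem hi hj =>
      Ideal.mem_of_dvd _ (aux_dvd i j hij m _ hi hj) (Ideal.subset_span hmem)
    by_contra hcon
    have e : ∀ i j : Fin 5, i ≠ j → (X i * X j : MvPolynomial (Fin 5) K) ∈
        ({X 0 * X 2, X 0 * X 3, X 1 * X 3, X 1 * X 4, X 2 * X 4} :
          Set (MvPolynomial (Fin 5) K)) → killHom K m (X i * X j) = 0 := by
      intro i j hij hmem
      by_cases hi : m i = 0
      · simp [killHom, hi]
      by_cases hj : m j = 0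
      · simp [killHom, hj]
      exact absurd (gen i j hij hmem hi hj) hcon
    have hker : Ideal.span ({X 0 * X 2, X 0 * X 3 + X 1 * X 4, X 1 * X 3 + X 2 * X 4} :
        Set (MvPolynomial (Fin 5) K)) ≤ RingHom.ker (killHom K m) := by
      refine hJI.trans ?_
      rw [Ideal.span_le]
      simp only [Set.insert_subset_iff, Set.singleton_subset_iff, SetLike.mem_coe,
        RingHom.mem_ker]
      exact ⟨e 0 2 (by decide) (by simp), e 0 3 (by decide) (by simp),
        e 1 3 (by decide) (by simp), e 1 4 (by decide) (by simp),
        e 2 4 (by decide) (by simp)⟩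
    have h0 := hker hn
    rw [RingHom.mem_ker, map_pow] at h0
    exact mem_support_iff.1 hm (killHom_coeff m f (eq_zero_of_pow_eq_zero h0))
end

section
/- Let m ≥ 2 be an integer, K a field, and R = K[x1,…,x_{3m+3}]. Let I_m be the ideal of R generated by the monomials x1x2 together with, for n = 1,…,m, x_{3n−2}x_{3n+2}, x_{3n+1}x_{3n+3}, x_{3n+1}x_{3n+2}, x_{3n−1}x_{3n+3}. Let Q be the ideal of R generated by the set of variables T = {x2} ∪ {x_{3n+1}, x_{3n+2} : n = 1,…,m−1} ∪ {x_{3m+1}}. Then Q is a minimal prime ideal over I_m and the height of Q equals 2m. -/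
/-- The variable `x k` (1-based indexing) of `K[x₁,…,x_{3m+3}]`; by convention it is `0`
for an out-of-range index `k` (all indices used below are in range). -/
noncomputable def xv (m : ℕ) (K : Type*) [Field K] (k : ℕ) :
    MvPolynomial (Fin (3 * m + 3)) K :=
  if h : 1 ≤ k ∧ k ≤ 3 * m + 3 then MvPolynomial.X ⟨k - 1, by omega⟩ else 0

/-- The generating set of the ideal `I_m`: the monomials `x₁x₂` together with, for
`n = 1, …, m`, `x_{3n-2}x_{3n+2}`, `x_{3n+1}x_{3n+3}`, `x_{3n+1}x_{3n+2}` and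
`x_{3n-1}x_{3n+3}`. -/
noncomputable def ImGens (m : ℕ) (K : Type*) [Field K] :
    Set (MvPolynomial (Fin (3 * m + 3)) K) :=
  {xv m K 1 * xv m K 2} ∪
    ⋃ n ∈ Set.Icc 1 m,
      ({xv m K (3 * n - 2) * xv m K (3 * n + 2),
        xv m K (3 * n + 1) * xv m K (3 * n + 3),
        xv m K (3 * n + 1) * xv m K (3 * n + 2),
        xv m K (3 * n - 1) * xv m K (3 * n + 3)} :
        Set (MvPolynomial (Fin (3 * m + 3)) K))

/-- The set of variables `T = {x₂} ∪ {x_{3n+1}, x_{3n+2} : n = 1, …, m-1} ∪ {x_{3m+1}}`. -/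
noncomputable def Tvars (m : ℕ) (K : Type*) [Field K] :
    Set (MvPolynomial (Fin (3 * m + 3)) K) :=
  {xv m K 2} ∪
    (⋃ n ∈ Set.Icc 1 (m - 1),
      ({xv m K (3 * n + 1), xv m K (3 * n + 2)} :
        Set (MvPolynomial (Fin (3 * m + 3)) K))) ∪
    {xv m K (3 * m + 1)}

open MvPolynomial in
/-- Kill the variables in `s`. -/
noncomputable def killVars {σ K : Type*} [Field K] (s : Set σ) :
    MvPolynomial σ K →ₐ[K] MvPolynomial σ K :=
  open Classical in aeval (fun i => if i ∈ s then 0 else X i)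

open MvPolynomial in
lemma ker_killVars {σ K : Type*} [Field K] (s : Set σ) :
    Ideal.span (X '' s : Set (MvPolynomial σ K)) =
      RingHom.ker (killVars s : MvPolynomial σ K →ₐ[K] MvPolynomial σ K) := by
  classical
  apply le_antisymm
  · rw [Ideal.span_le]
    rintro _ ⟨i, hi, rfl⟩
    simp [killVars, RingHom.mem_ker, hi]
  · intro f hf
    have key : (Ideal.Quotient.mkₐ K (Ideal.span (X '' s : Set (MvPolynomial σ K)))).comp
        (killVars s) = Ideal.Quotient.mkₐ K _ := by
      apply MvPolynomial.algHom_ext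
      intro i
      by_cases hi : i ∈ s
      · have : (X i : MvPolynomial σ K) ∈ Ideal.span (X '' s : Set (MvPolynomial σ K)) :=
          Ideal.subset_span ⟨i, hi, rfl⟩
        simpa [killVars, hi] using (Ideal.Quotient.eq_zero_iff_mem.mpr this).symm
      · simp [killVars, hi]
    have h2 := DFunLike.congr_fun key f
    rw [AlgHom.comp_apply, (RingHom.mem_ker).mp hf, map_zero] at h2
    exact Ideal.Quotient.eq_zero_iff_mem.mp h2.symm

open MvPolynomial in
lemma span_vars_isPrime {σ K : Type*} [Field K] (s : Set σ) :
    (Ideal.span (X '' s : Set (MvPolynomial σ K))).IsPrime := by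
  rw [ker_killVars]
  exact RingHom.ker_isPrime _

open MvPolynomial in
lemma X_mem_span_vars {σ K : Type*} [Field K] (s : Set σ) (i : σ) :
    (X i : MvPolynomial σ K) ∈ Ideal.span (X '' s : Set (MvPolynomial σ K)) ↔ i ∈ s := by
  classical
  rw [ker_killVars, RingHom.mem_ker]
  by_cases hi : i ∈ s <;> simp [killVars, hi]

open MvPolynomial in
lemma card_le_height {σ K : Type*} [Field K] (s : Finset σ) :
    (s.card : ℕ∞) ≤ Order.height (⟨Ideal.span (X '' (s : Set σ)), span_vars_isPrime _⟩ :
      PrimeSpectrum (MvPolynomial σ K)) := by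
  classical
  induction s using Finset.induction_on with
  | empty => simp
  | insert a s ha ih =>
    rw [Finset.card_insert_of_notMem ha]
    have hlt : (⟨Ideal.span (X '' (s : Set σ)), span_vars_isPrime _⟩ :
      PrimeSpectrum (MvPolynomial σ K)) <
      ⟨Ideal.span (X '' ((insert a s : Finset σ) : Set σ)), span_vars_isPrime _⟩ := by
      rw [← PrimeSpectrum.asIdeal_lt_asIdeal]
      refine lt_of_le_not_ge (Ideal.span_mono (Set.image_mono (by simp))) fun h => ha ?_
      have := (X_mem_span_vars (K := K) (s : Set σ) a).mp
        (h ((X_mem_span_vars _ _).mpr (by simp)))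
      simpa using this
    rw [Nat.cast_add, Nat.cast_one]
    exact (add_le_add_left ih 1).trans (Order.height_add_one_le hlt)

open MvPolynomial in
lemma height_span_vars {σ K : Type*} [Finite σ] [Field K] (s : Finset σ) :
    Order.height (⟨Ideal.span (X '' (s : Set σ)), span_vars_isPrime _⟩ :
      PrimeSpectrum (MvPolynomial σ K)) = (s.card : ℕ∞) := by
  classical
  apply le_antisymm _ (card_le_height s)
  have hp := span_vars_isPrime (K := K) (s : Set σ)
  have h := Ideal.height_le_card_of_mem_minimalPrimes_span_finset
    (p := Ideal.span (X '' (s : Set σ) : Set (MvPolynomial σ K)))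
    (s := s.image (X : σ → MvPolynomial σ K))
    (by rw [Finset.coe_image, Ideal.minimalPrimes_eq_subsingleton_self]; rfl)
  have h' := PrimeSpectrum.height_eq_orderHeight (⟨_, hp⟩ : PrimeSpectrum (MvPolynomial σ K))
  replace h := h'.symm.trans_le h
  exact h.trans (by exact_mod_cast Finset.card_image_le)

/-- Index set of the variables in `T` (zero based). -/
def Tidx (m : ℕ) : Finset (Fin (3 * m + 3)) :=
  Finset.univ.filter fun i => i.val = 1 ∨ (3 ≤ i.val ∧ i.val ≤ 3 * m ∧ i.val % 3 ≠ 2)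

lemma Tidx_card (m : ℕ) (hm : 1 ≤ m) : (Tidx m).card = 2 * m := by
  have : (Tidx m).card = (Finset.range (2 * m)).card := by
    symm
    refine Finset.card_bij (fun k hk => ⟨if k = 0 then 1 else 3 * ((k + 1) / 2) + (k + 1) % 2, ?_⟩)
      ?_ ?_ ?_
    · have := Finset.mem_range.mp hk
      split_ifs <;> omega
    · intro k hk
      have := Finset.mem_range.mp hk
      simp only [Tidx, Finset.mem_filter, Finset.mem_univ, true_and]
      split_ifs <;> omega
    · intro a ha b hb h
      simp only [Fin.mk.injEq] at h
      split_ifs at h <;> omega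
    · intro i hi
      simp only [Tidx, Finset.mem_filter, Finset.mem_univ, true_and] at hi
      refine ⟨if i.val = 1 then 0 else 2 * (i.val / 3) - 1 + i.val % 3, ?_, ?_⟩
      · rw [Finset.mem_range]
        split_ifs <;> omega
      · apply Fin.ext
        simp only
        split_ifs <;> omega
  simpa using this

lemma Tvars_eq (m : ℕ) (hm : 1 ≤ m) (K : Type*) [Field K] :
    Tvars m K = MvPolynomial.X '' (Tidx m : Set (Fin (3 * m + 3))) := by
  have hx : ∀ k, 1 ≤ k → (h : k ≤ 3 * m + 3) →
      (k = 2 ∨ (4 ≤ k ∧ k ≤ 3 * m + 1 ∧ k % 3 ≠ 0)) →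
      xv m K k ∈ MvPolynomial.X '' (Tidx m : Set (Fin (3 * m + 3))) := by
    intro k h1 h2 h3
    rw [xv, dif_pos ⟨h1, h2⟩]
    refine ⟨_, ?_, rfl⟩
    simp only [Tidx, Finset.coe_filter, Finset.mem_univ, true_and, Set.mem_ofPred_eq]
    omega
  apply Set.Subset.antisymm
  · rintro f ((hf | hf) | hf)
    · rw [Set.mem_singleton_iff.mp hf]
      exact hx _ (by omega) (by omega) (by omega)
    · simp only [Set.mem_iUnion, Set.mem_Icc] at hf
      obtain ⟨n, hn, hf | hf⟩ := hf
      · rw [hf]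
        exact hx _ (by omega) (by omega) (by omega)
      · rw [Set.mem_singleton_iff.mp hf]
        exact hx _ (by omega) (by omega) (by omega)
    · rw [Set.mem_singleton_iff.mp hf]
      exact hx _ (by omega) (by omega) (by omega)
  · rintro _ ⟨i, hi, rfl⟩
    simp only [Tidx, Finset.coe_filter, Finset.mem_univ, true_and, Set.mem_ofPred_eq] at hi
    have hX : (MvPolynomial.X i : MvPolynomial (Fin (3 * m + 3)) K) = xv m K (i.val + 1) := by
      rw [xv, dif_pos ⟨by omega, by omega⟩]
      simp
    rw [hX]
    by_cases h1 : i.val = 1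
    · left; left; simp [h1]
    by_cases h2 : i.val = 3 * m
    · right; simp [h2]
    left; right
    simp only [Set.mem_iUnion, Set.mem_Icc]
    refine ⟨i.val / 3, by omega, ?_⟩
    by_cases h3 : i.val % 3 = 0
    · left; congr 1; omega
    · right; rw [Set.mem_singleton_iff]; congr 1; omega

lemma xv_mem_iff (m : ℕ) (hm : 1 ≤ m) (K : Type*) [Field K] (k : ℕ) (h1 : 1 ≤ k)
    (h2 : k ≤ 3 * m + 3) : xv m K k ∈ Ideal.span (Tvars m K) ↔
      (k = 2 ∨ (4 ≤ k ∧ k ≤ 3 * m + 1 ∧ k % 3 ≠ 0)) := by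
  rw [Tvars_eq m hm, xv, dif_pos ⟨h1, h2⟩, X_mem_span_vars]
  simp only [Tidx, Finset.coe_filter, Finset.mem_univ, true_and, Set.mem_ofPred_eq]
  omega

/-- **Example 4 (Barile).** For `m ≥ 2`, the ideal `Q = (T)` generated by the variables
`T = {x₂} ∪ {x_{3n+1}, x_{3n+2} : n = 1, …, m-1} ∪ {x_{3m+1}}` is a minimal prime over
`I_m`, of height `2m` (the height of a prime being the supremum of the lengths of chains
of primes descending from it). -/
theorem Tvars_span_minimalPrime_height (m : ℕ) (hm : 2 ≤ m) (K : Type*) [Field K] :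
    ∃ hQ : (Ideal.span (Tvars m K)).IsPrime,
      Ideal.span (Tvars m K) ∈ (Ideal.span (ImGens m K)).minimalPrimes ∧
        Order.height (⟨Ideal.span (Tvars m K), hQ⟩ :
          PrimeSpectrum (MvPolynomial (Fin (3 * m + 3)) K)) = (2 * m : ℕ) := by
  have hm1 : 1 ≤ m := by omega
  have hQ : (Ideal.span (Tvars m K)).IsPrime := by
    rw [Tvars_eq m hm1]; exact span_vars_isPrime _
  have hmem := xv_mem_iff m hm1 K
  refine ⟨hQ, ⟨⟨hQ, ?_⟩, ?_⟩, ?_⟩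
  · rw [Ideal.span_le]
    have L : ∀ a b, 1 ≤ a → a ≤ 3 * m + 3 → (a = 2 ∨ (4 ≤ a ∧ a ≤ 3 * m + 1 ∧ a % 3 ≠ 0)) →
        xv m K a * xv m K b ∈ Ideal.span (Tvars m K) := fun a b h1 h2 h3 =>
      Ideal.mul_mem_right _ _ ((hmem a h1 h2).mpr h3)
    have R : ∀ a b, 1 ≤ b → b ≤ 3 * m + 3 → (b = 2 ∨ (4 ≤ b ∧ b ≤ 3 * m + 1 ∧ b % 3 ≠ 0)) →
        xv m K a * xv m K b ∈ Ideal.span (Tvars m K) := fun a b h1 h2 h3 =>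
      Ideal.mul_mem_left _ _ ((hmem b h1 h2).mpr h3)
    rintro f (hf | hf)
    · rw [Set.mem_singleton_iff.mp hf]
      exact R _ _ (by omega) (by omega) (by omega)
    · simp only [Set.mem_iUnion, Set.mem_Icc] at hf
      obtain ⟨n, hn, rfl | rfl | rfl | hf⟩ := hf
      · by_cases h : n = m
        · exact L _ _ (by omega) (by omega) (by omega)
        · exact R _ _ (by omega) (by omega) (by omega)
      · exact L _ _ (by omega) (by omega) (by omega)
      · exact L _ _ (by omega) (by omega) (by omega)
      · rw [Set.mem_singleton_iff.mp hf]
        exact L _ _ (by omega) (by omega) (by omega)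
  · rintro P ⟨hP, hIP⟩ hPQ
    have hgen : ∀ f ∈ ImGens m K, f ∈ P := fun f hf => hIP (Ideal.subset_span hf)
    have hn : ∀ b, 1 ≤ b → b ≤ 3 * m + 3 →
        ¬ (b = 2 ∨ (4 ≤ b ∧ b ≤ 3 * m + 1 ∧ b % 3 ≠ 0)) → xv m K b ∉ P :=
      fun b h1 h2 h3 h => h3 ((hmem b h1 h2).mp (hPQ h))
    have h13 : ∀ n, 1 ≤ n → n ≤ m → xv m K (3 * n + 1) ∈ P := by
      intro n h1 h2
      have := hgen (xv m K (3 * n + 1) * xv m K (3 * n + 3)) (by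
        right
        simp only [Set.mem_iUnion, Set.mem_Icc]
        exact ⟨n, ⟨h1, h2⟩, by simp⟩)
      exact (hP.mem_or_mem this).resolve_right (hn _ (by omega) (by omega) (by omega))
    have h23 : ∀ n, 1 ≤ n → n ≤ m → xv m K (3 * n - 1) ∈ P := by
      intro n h1 h2
      have := hgen (xv m K (3 * n - 1) * xv m K (3 * n + 3)) (by
        right
        simp only [Set.mem_iUnion, Set.mem_Icc]
        exact ⟨n, ⟨h1, h2⟩, by simp⟩)
      exact (hP.mem_or_mem this).resolve_right (hn _ (by omega) (by omega) (by omega))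
    rw [Ideal.span_le]
    rintro f ((hf | hf) | hf)
    · rw [Set.mem_singleton_iff.mp hf]
      exact h23 1 (by omega) (by omega)
    · simp only [Set.mem_iUnion, Set.mem_Icc] at hf
      obtain ⟨n, hn, hf | hf⟩ := hf
      · rw [hf]
        exact h13 n (by omega) (by omega)
      · rw [Set.mem_singleton_iff.mp hf]
        exact h23 (n + 1) (by omega) (by omega)
    · rw [Set.mem_singleton_iff.mp hf]
      exact h13 m (by omega) (by omega)
  · have h := height_span_vars (K := K) (Tidx m)
    rw [Tidx_card m hm1] at h
    rw [← h]
    congr 2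
    rw [Tvars_eq m hm1]
end

section
/- Let m ≥ 2 be an integer, K a field, and R = K[x1,…,x_{3m+3}]. Let I_m be the ideal of R generated by the monomials x1x2 together with, for n = 1,…,m, x_{3n−2}x_{3n+2}, x_{3n+1}x_{3n+3}, x_{3n+1}x_{3n+2}, x_{3n−1}x_{3n+3}. Then I_m is not a set-theoretic complete intersection: the height of I_m is strictly smaller than the arithmetical rank of I_m. -/
/-- The height of an ideal `I`: the minimum of the heights of the minimal primes over
`I`, the height of a prime being the supremum of the lengths of chains of primes
descending from it. -/
noncomputable def idealHeight {R : Type*} [CommRing R] (I : Ideal R) : ℕ∞ :=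
  sInf {h : ℕ∞ | ∃ (P : Ideal R) (hP : P.IsPrime), P ∈ I.minimalPrimes ∧
    h = Order.height (⟨P, hP⟩ : PrimeSpectrum R)}

/-- The arithmetical rank of an ideal `I`: the least number `n` such that some `n`
elements of the ring generate an ideal with the same radical as `I`. -/
noncomputable def ara {R : Type*} [CommRing R] (I : Ideal R) : ℕ :=
  sInf {n : ℕ | ∃ f : Fin n → R, (Ideal.span (Set.range f)).radical = I.radical}

open MvPolynomial in
/-- The ideal generated by a set of variables, described as the kernel of the substitution
that kills these variables. -/
theorem span_X_eq_ker {σ : Type*} (K : Type*) [Field K] (s : Set σ)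
    [DecidablePred (· ∈ s)] :
    Ideal.span (X '' s : Set (MvPolynomial σ K)) =
      RingHom.ker (aeval (fun i => if i ∈ s then (0 : MvPolynomial σ K) else X i)) := by
  set φ : MvPolynomial σ K →ₐ[K] MvPolynomial σ K :=
    aeval (fun i => if i ∈ s then (0 : MvPolynomial σ K) else X i) with hφ
  apply le_antisymm
  · rw [Ideal.span_le]
    rintro _ ⟨i, hi, rfl⟩
    simp [hφ, RingHom.mem_ker, hi]
  · intro f hf
    have key : (Ideal.Quotient.mkₐ K (Ideal.span (X '' s : Set (MvPolynomial σ K)))).comp φ =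
        Ideal.Quotient.mkₐ K (Ideal.span (X '' s : Set (MvPolynomial σ K))) := by
      apply MvPolynomial.algHom_ext
      intro i
      by_cases hi : i ∈ s
      · have : (X i : MvPolynomial σ K) ∈ Ideal.span (X '' s : Set (MvPolynomial σ K)) :=
          Ideal.subset_span ⟨i, hi, rfl⟩
        simp [hφ, hi, (Ideal.Quotient.eq_zero_iff_mem.mpr this)]
      · simp [hφ, hi]
    have h2 := DFunLike.congr_fun key f
    have hf' : φ f = 0 := hf
    simp only [AlgHom.comp_apply, hf', map_zero] at h2
    exact Ideal.Quotient.eq_zero_iff_mem.mp h2.symm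

open MvPolynomial in
theorem span_X_isPrime {σ : Type*} (K : Type*) [Field K] (s : Set σ) :
    (Ideal.span (X '' s : Set (MvPolynomial σ K))).IsPrime := by
  classical
  rw [span_X_eq_ker]
  exact RingHom.ker_isPrime _

open MvPolynomial in
theorem X_mem_span_X {σ : Type*} (K : Type*) [Field K] (s : Set σ) (i : σ) :
    (X i : MvPolynomial σ K) ∈ Ideal.span (X '' s : Set (MvPolynomial σ K)) ↔ i ∈ s := by
  classical
  rw [span_X_eq_ker, RingHom.mem_ker]
  by_cases hi : i ∈ s <;> simp [hi]

open MvPolynomial in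
theorem card_le_height_span_X {σ : Type*} (K : Type*) [Field K] (s : Finset σ) :
    (s.card : ℕ∞) ≤ (Ideal.span (X '' (s : Set σ) : Set (MvPolynomial σ K))).height := by
  classical
  induction s using Finset.induction_on with
  | empty => simp
  | insert a s ha ih =>
    rw [Finset.card_insert_of_notMem ha]
    have p1 := span_X_isPrime K (s : Set σ)
    have p2 := span_X_isPrime K ((insert a s : Finset σ) : Set σ)
    have hlt : Ideal.span (X '' (s : Set σ) : Set (MvPolynomial σ K)) <
        Ideal.span (X '' ((insert a s : Finset σ) : Set σ) : Set (MvPolynomial σ K)) := by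
      refine lt_of_le_not_ge (Ideal.span_mono (Set.image_mono (by simp))) fun h => ?_
      have h1 : (X a : MvPolynomial σ K) ∈
          Ideal.span (X '' ((insert a s : Finset σ) : Set σ) : Set (MvPolynomial σ K)) :=
        (X_mem_span_X K _ a).mpr (by simp)
      exact ha (by simpa using (X_mem_span_X K _ a).mp (h h1))
    have := Ideal.height_add_one_le_of_lt_of_isPrime hlt
    rw [Nat.cast_add, Nat.cast_one]
    exact (add_le_add_left ih 1).trans this

open MvPolynomial in
theorem xv_eq (m : ℕ) (K : Type*) [Field K] (k i : ℕ) (hi : i < 3 * m + 3) (h : k = i + 1) :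
    xv m K k = X ⟨i, hi⟩ := by
  subst h
  unfold xv
  rw [dif_pos (by omega)]
  rfl

open MvPolynomial in
/-- A vertex cover gives an ideal containing `I_m`. -/
theorem Im_le_span_X (m : ℕ) (K : Type*) [Field K] (s : Set (Fin (3 * m + 3)))
    (h0 : ⟨0, by omega⟩ ∈ s ∨ ⟨1, by omega⟩ ∈ s)
    (h : ∀ n, (hn : n < m) →
      (⟨3 * n, by omega⟩ ∈ s ∨ ⟨3 * n + 4, by omega⟩ ∈ s) ∧
      (⟨3 * n + 3, by omega⟩ ∈ s ∨ ⟨3 * n + 5, by omega⟩ ∈ s) ∧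
      (⟨3 * n + 3, by omega⟩ ∈ s ∨ ⟨3 * n + 4, by omega⟩ ∈ s) ∧
      (⟨3 * n + 1, by omega⟩ ∈ s ∨ ⟨3 * n + 5, by omega⟩ ∈ s)) :
    Ideal.span (ImGens m K) ≤ Ideal.span (X '' s) := by
  have aux : ∀ i j : Fin (3 * m + 3), i ∈ s ∨ j ∈ s →
      (X i * X j : MvPolynomial (Fin (3 * m + 3)) K) ∈ Ideal.span (X '' s) := by
    rintro i j (hi | hj)
    · exact Ideal.mul_mem_right _ _ (Ideal.subset_span ⟨i, hi, rfl⟩)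
    · exact Ideal.mul_mem_left _ _ (Ideal.subset_span ⟨j, hj, rfl⟩)
  rw [Ideal.span_le]
  rintro f (hf | hf)
  · rw [Set.mem_singleton_iff] at hf
    rw [hf, xv_eq m K 1 0 (by omega) rfl, xv_eq m K 2 1 (by omega) rfl]
    exact aux _ _ h0
  · simp only [Set.mem_iUnion] at hf
    obtain ⟨n, ⟨hn1, hnm⟩, hf⟩ := hf
    obtain ⟨n, rfl⟩ : ∃ k, n = k + 1 := ⟨n - 1, by omega⟩
    obtain ⟨e1, e2, e3, e4⟩ := h n (by omega)
    rw [xv_eq m K (3 * (n + 1) - 2) (3 * n) (by omega) (by omega),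
      xv_eq m K (3 * (n + 1) - 1) (3 * n + 1) (by omega) (by omega),
      xv_eq m K (3 * (n + 1) + 1) (3 * n + 3) (by omega) (by omega),
      xv_eq m K (3 * (n + 1) + 2) (3 * n + 4) (by omega) (by omega),
      xv_eq m K (3 * (n + 1) + 3) (3 * n + 5) (by omega) (by omega)] at hf
    rcases hf with hf | hf | hf | hf
    · rw [hf]; exact aux _ _ e1
    · rw [hf]; exact aux _ _ e2
    · rw [hf]; exact aux _ _ e3
    · rw [hf]; exact aux _ _ e4

/-- The small vertex cover. -/
def smallF (m : ℕ) (j : Fin (2 * m)) : Fin (3 * m + 3) :=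
  if h : j.1 < m then ⟨3 * j.1 + 1, by omega⟩
  else ⟨3 * (j.1 - m) + 3, by omega⟩

/-- The large minimal vertex cover. -/
def bigF (m : ℕ) (j : Fin (2 * m + 1)) : Fin (3 * m + 3) :=
  if h : j.1 ≤ m then ⟨3 * j.1, by omega⟩ else ⟨3 * (j.1 - (m + 1)) + 5, by omega⟩

theorem smallF_val (m : ℕ) (j : Fin (2 * m)) :
    (smallF m j).1 = if j.1 < m then 3 * j.1 + 1 else 3 * (j.1 - m) + 3 := by
  unfold smallF
  split_ifs with h <;> rfl

theorem bigF_val (m : ℕ) (j : Fin (2 * m + 1)) :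
    (bigF m j).1 = if j.1 ≤ m then 3 * j.1 else 3 * (j.1 - (m + 1)) + 5 := by
  unfold bigF
  split_ifs with h <;> rfl

theorem bigF_injective (m : ℕ) : Function.Injective (bigF m) := by
  intro a b h
  have := congrArg Fin.val h
  rw [bigF_val, bigF_val] at this
  apply Fin.ext
  split_ifs at this <;> omega

theorem mem_small_b (m n : ℕ) (h : n < m) (h' : 3 * n + 1 < 3 * m + 3) :
    (⟨3 * n + 1, h'⟩ : Fin (3 * m + 3)) ∈ Set.range (smallF m) := by
  refine ⟨⟨n, by omega⟩, Fin.ext ?_⟩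
  rw [smallF_val]; simp [h]

theorem mem_small_a (m n : ℕ) (h : n < m) (h' : 3 * n + 3 < 3 * m + 3) :
    (⟨3 * n + 3, h'⟩ : Fin (3 * m + 3)) ∈ Set.range (smallF m) := by
  refine ⟨⟨m + n, by omega⟩, Fin.ext ?_⟩
  rw [smallF_val]; simp

theorem mem_big_a (m n : ℕ) (h' : 3 * n < 3 * m + 3) :
    (⟨3 * n, h'⟩ : Fin (3 * m + 3)) ∈ Set.range (bigF m) := by
  refine ⟨⟨n, by omega⟩, Fin.ext ?_⟩
  rw [bigF_val, if_pos (by simp; omega)]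

theorem mem_big_c (m n : ℕ) (h' : 3 * n + 5 < 3 * m + 3) :
    (⟨3 * n + 5, h'⟩ : Fin (3 * m + 3)) ∈ Set.range (bigF m) := by
  refine ⟨⟨m + 1 + n, by omega⟩, Fin.ext ?_⟩
  rw [bigF_val, if_neg (by simp; omega)]
  simp

theorem not_mem_big_b (m n : ℕ) (h' : 3 * n + 1 < 3 * m + 3) :
    (⟨3 * n + 1, h'⟩ : Fin (3 * m + 3)) ∉ Set.range (bigF m) := by
  rintro ⟨j, hj⟩
  have := congrArg Fin.val hj
  rw [bigF_val] at this
  simp only at this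
  split_ifs at this <;> omega

open MvPolynomial in
theorem Im_height_le (m : ℕ) (hm : 2 ≤ m) (K : Type*) [Field K] :
    idealHeight (Ideal.span (ImGens m K)) ≤ ((2 * m : ℕ) : ℕ∞) := by
  have hle : Ideal.span (ImGens m K) ≤ Ideal.span (X '' (Set.range (smallF m))) := by
    refine Im_le_span_X m K _ (Or.inr (mem_small_b m 0 (by omega) _)) fun n hn =>
      ⟨?_, Or.inl (mem_small_a m n hn _), Or.inl (mem_small_a m n hn _),
        Or.inl (mem_small_b m n hn _)⟩
    by_cases h : n + 1 < m
    · exact Or.inr (mem_small_b m (n + 1) h (by omega))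
    · obtain ⟨n, rfl⟩ : ∃ k, n = k + 1 := ⟨n - 1, by omega⟩
      exact Or.inl (mem_small_a m n (by omega) (by omega))
  have hp := span_X_isPrime K (Set.range (smallF m))
  obtain ⟨Q, hQ, hQP⟩ := Ideal.exists_minimalPrimes_le hle
  have hQp : Q.IsPrime := hQ.1.1
  have h1 : idealHeight (Ideal.span (ImGens m K)) ≤ Q.height := by
    apply sInf_le
    exact ⟨Q, hQp, hQ, PrimeSpectrum.height_eq_orderHeight ⟨Q, hQp⟩⟩
  refine h1.trans ((Ideal.height_mono hQP).trans ?_)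
  classical
  have h2 := Ideal.height_le_card_of_mem_minimalPrimes_span
    (s := (X '' (Set.range (smallF m)) : Set (MvPolynomial (Fin (3 * m + 3)) K)))
    (Set.toFinite _) (p := Ideal.span (X '' (Set.range (smallF m))))
    (by rw [Ideal.minimalPrimes_eq_subsingleton_self]; rfl)
  refine h2.trans ?_
  norm_cast
  refine (Set.ncard_image_le (Set.toFinite _)).trans ?_
  rw [← Set.image_univ]
  refine (Set.ncard_image_le (Set.toFinite _)).trans ?_
  simp [Set.ncard_univ]

open MvPolynomial in
theorem big_mem_minimalPrimes (m : ℕ) (K : Type*) [Field K] :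
    Ideal.span (X '' (Set.range (bigF m))) ∈ (Ideal.span (ImGens m K)).minimalPrimes := by
  have hp := span_X_isPrime K (Set.range (bigF m))
  refine ⟨⟨hp, Im_le_span_X m K _ (Or.inl (mem_big_a m 0 _)) fun n hn =>
    ⟨Or.inl (mem_big_a m n _), Or.inl (mem_big_a m (n + 1) _), Or.inl (mem_big_a m (n + 1) _),
      Or.inr (mem_big_c m n _)⟩⟩, ?_⟩
  rintro Q ⟨hQ, hIQ⟩ hQP
  have aux : ∀ v w : Fin (3 * m + 3), w ∉ Set.range (bigF m) →
      (X v * X w : MvPolynomial (Fin (3 * m + 3)) K) ∈ ImGens m K → X v ∈ Q := by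
    intro v w hw h
    refine (hQ.mem_or_mem (hIQ (Ideal.subset_span h))).resolve_right fun h' => hw ?_
    exact (X_mem_span_X K _ w).mp (hQP h')
  have gen : ∀ n, 1 ≤ n → n ≤ m → ∀ f, f ∈ ({xv m K (3 * n - 2) * xv m K (3 * n + 2),
        xv m K (3 * n + 1) * xv m K (3 * n + 3),
        xv m K (3 * n + 1) * xv m K (3 * n + 2),
        xv m K (3 * n - 1) * xv m K (3 * n + 3)} :
        Set (MvPolynomial (Fin (3 * m + 3)) K)) → f ∈ ImGens m K := by
    intro n h1 h2 f hf
    refine Or.inr ?_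
    simp only [Set.mem_iUnion]
    exact ⟨n, ⟨h1, h2⟩, hf⟩
  rw [Ideal.span_le]
  rintro _ ⟨v, ⟨j, rfl⟩, rfl⟩
  by_cases hj : j.1 ≤ m
  · refine aux _ ⟨3 * j.1 + 1, by omega⟩ (not_mem_big_b _ _ _) ?_
    have hv : bigF m j = ⟨3 * j.1, by omega⟩ := Fin.ext (by rw [bigF_val, if_pos hj])
    rw [hv]
    rcases Nat.eq_zero_or_pos j.1 with h0 | h0
    · refine Or.inl ?_
      rw [Set.mem_singleton_iff, xv_eq m K 1 (3 * j.1) (by omega) (by omega),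
        xv_eq m K 2 (3 * j.1 + 1) (by omega) (by omega)]
    · refine gen j.1 h0 hj _ (Or.inr (Or.inr (Or.inl ?_)))
      rw [xv_eq m K (3 * j.1 + 1) (3 * j.1) (by omega) (by omega),
        xv_eq m K (3 * j.1 + 2) (3 * j.1 + 1) (by omega) (by omega)]
  · obtain ⟨n, hn⟩ : ∃ n, j.1 = m + 1 + n := ⟨j.1 - (m + 1), by omega⟩
    have hv : bigF m j = ⟨3 * n + 5, by omega⟩ := Fin.ext (by
      rw [bigF_val, if_neg hj]; simp only; omega)
    rw [hv]
    refine aux _ ⟨3 * n + 1, by omega⟩ (not_mem_big_b _ _ _) ?_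
    refine gen (n + 1) (by omega) (by omega) _ (Or.inr (Or.inr (Or.inr ?_)))
    rw [Set.mem_singleton_iff, xv_eq m K (3 * (n + 1) - 1) (3 * n + 1) (by omega) (by omega),
      xv_eq m K (3 * (n + 1) + 3) (3 * n + 5) (by omega) (by omega)]
    exact mul_comm _ _

open MvPolynomial in
theorem le_ara_Im (m : ℕ) (K : Type*) [Field K] :
    2 * m + 1 ≤ ara (Ideal.span (ImGens m K)) := by
  classical
  have hne : {n : ℕ | ∃ f : Fin n → MvPolynomial (Fin (3 * m + 3)) K,
      (Ideal.span (Set.range f)).radical = (Ideal.span (ImGens m K)).radical}.Nonempty := by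
    obtain ⟨n, f, hf⟩ := Submodule.fg_iff_exists_fin_generating_family.mp
      (IsNoetherian.noetherian (Ideal.span (ImGens m K)))
    exact ⟨n, f, congrArg Ideal.radical hf⟩
  unfold ara
  obtain ⟨f, hf⟩ := Nat.sInf_mem hne
  have hmin := big_mem_minimalPrimes m K
  rw [← Ideal.radical_minimalPrimes, ← hf, Ideal.radical_minimalPrimes] at hmin
  have h1 := Ideal.height_le_card_of_mem_minimalPrimes_span (Set.toFinite _) hmin
  have h2 := card_le_height_span_X K (Finset.univ.image (bigF m))
  rw [Finset.card_image_of_injective _ (bigF_injective m), Finset.card_univ, Fintype.card_fin,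
    Finset.coe_image, Finset.coe_univ, Set.image_univ] at h2
  have h3 := h2.trans h1
  norm_cast at h3
  refine h3.trans ?_
  rw [← Set.image_univ]
  refine (Set.ncard_image_le (Set.toFinite _)).trans ?_
  simp [Set.ncard_univ]

/-- **Example 4 (Barile).** For `m ≥ 2`, the ideal `I_m` is not a set-theoretic complete
intersection: its height is strictly smaller than its arithmetical rank. -/
theorem Im_not_stci (m : ℕ) (hm : 2 ≤ m) (K : Type*) [Field K] :
    idealHeight (Ideal.span (ImGens m K)) < (ara (Ideal.span (ImGens m K)) : ℕ∞) := by
  refine (Im_height_le m hm K).trans_lt ?_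
  have := le_ara_Im m K
  exact_mod_cast this
end

section
/- Let K be a field of characteristic different from 2 and R = K[x1,…,x6]. Let I be the ideal of R generated by x1x3, x1x4, x1x6, x2x4, x2x5, x2x6, x3x5, x3x6, x4x5x6. Then I equals the radical of the ideal J generated by the four polynomials x1x4 + x3x5, x1x3 + x2x6 + x4x5x6, x1x6 + x2x5, x2x4 + x3x6. -/
open MvPolynomial

/-- The evaluation killing the variables outside `S` keeps the coefficient of a monomial
supported on `S`. -/
lemma coeff_kill {K : Type*} [Field K] (m : Fin 6 →₀ ℕ) (g : MvPolynomial (Fin 6) K) :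
    coeff m (aeval (fun i => if i ∈ m.support then (X i : MvPolynomial (Fin 6) K) else 0) g)
      = coeff m g := by
  classical
  induction g using MvPolynomial.induction_on' with
  | add p q hp hq => rw [map_add, coeff_add, coeff_add, hp, hq]
  | monomial u a =>
    rw [aeval_monomial]
    by_cases h : u.support ⊆ m.support
    · have : (u.prod fun i k =>
          (if i ∈ m.support then (X i : MvPolynomial (Fin 6) K) else 0) ^ k)
          = u.prod fun i k => X i ^ k := by
        refine Finset.prod_congr rfl fun i hi => ?_
        simp only [if_pos (h hi)]
      rw [this, algebraMap_eq, ← monomial_eq]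
    · obtain ⟨i, hi, him⟩ := Finset.not_subset.1 h
      have h0 : (u.prod fun i k =>
          (if i ∈ m.support then (X i : MvPolynomial (Fin 6) K) else 0) ^ k) = 0 := by
        refine Finset.prod_eq_zero hi ?_
        simp only [if_neg him]
        exact zero_pow (Finsupp.mem_support_iff.1 hi)
      have hne : u ≠ m := by
        rintro rfl
        exact h subset_rfl
      rw [h0, mul_zero, coeff_zero, coeff_monomial, if_neg hne]

lemma prod_X_dvd {K : Type*} [Field K] (m : Fin 6 →₀ ℕ) (T : Finset (Fin 6))
    (h : T ⊆ m.support) :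
    (∏ i ∈ T, (X i : MvPolynomial (Fin 6) K)) ∣ monomial m 1 := by
  rw [monomial_eq, C_1, one_mul]
  refine dvd_trans (Finset.prod_dvd_prod_of_subset _ _ _ h) ?_
  exact Finset.prod_dvd_prod_of_dvd _ _ fun i hi =>
    dvd_pow_self _ (Finsupp.mem_support_iff.1 hi)

/-- Squarefree monomial ideals are radical. -/
lemma squarefree_isRadical {K : Type*} [Field K] (A : Set (Finset (Fin 6))) :
    (Ideal.span ((fun T : Finset (Fin 6) => ∏ i ∈ T, (X i : MvPolynomial (Fin 6) K)) '' A)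
      ).IsRadical := by
  classical
  rintro g ⟨n, hn⟩
  rw [g.as_sum]
  refine Ideal.sum_mem _ fun m hm => ?_
  have hmon : monomial m (coeff m g) = C (coeff m g) * monomial m 1 := by
    rw [C_mul_monomial, mul_one]
  rw [hmon]
  refine Ideal.mul_mem_left _ _ ?_
  by_cases h : ∃ T ∈ A, T ⊆ m.support
  · obtain ⟨T, hT, hs⟩ := h
    exact Ideal.mem_of_dvd _ (prod_X_dvd m T hs) (Ideal.subset_span ⟨T, hT, rfl⟩)
  · exfalso
    push Not at h
    let φ : MvPolynomial (Fin 6) K →ₐ[K] MvPolynomial (Fin 6) K :=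
      aeval (fun i => if i ∈ m.support then (X i : MvPolynomial (Fin 6) K) else 0)
    have hker : Ideal.span
        ((fun T : Finset (Fin 6) => ∏ i ∈ T, (X i : MvPolynomial (Fin 6) K)) '' A)
        ≤ RingHom.ker φ := by
      rw [Ideal.span_le]
      rintro _ ⟨T, hT, rfl⟩
      obtain ⟨i, hi, him⟩ := Finset.not_subset.1 (h T hT)
      change φ _ = 0
      rw [map_prod]
      refine Finset.prod_eq_zero hi ?_
      simp only [φ, aeval_X, if_neg him]
    have h1 : φ (g ^ n) = 0 := hker hn
    rw [map_pow] at h1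
    have h2 : φ g = 0 := eq_zero_of_pow_eq_zero h1
    have h3 := coeff_kill m g
    change coeff m (φ g) = _ at h3
    rw [h2, coeff_zero] at h3
    exact (mem_support_iff.1 hm) h3.symm

/-- The vanishing argument in a domain where `2 ≠ 0`. -/
lemma domain_vanish {D : Type*} [CommRing D] [IsDomain D] (h2 : (2 : D) ≠ 0)
    (a b c d e f : D) (h₁ : a * d + c * e = 0) (h₂ : a * c + b * f + d * e * f = 0)
    (h₃ : a * f + b * e = 0) (h₄ : b * d + c * f = 0) :
    a * c = 0 ∧ a * d = 0 ∧ a * f = 0 ∧ b * d = 0 ∧ b * e = 0 ∧ b * f = 0 ∧ c * e = 0 ∧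
      c * f = 0 ∧ d * e * f = 0 := by
  have hdef : d * e * f = 0 := by
    by_contra hne
    have ha : a = 0 := by
      have : (2 * (d * e * f)) * a = 0 := by
        linear_combination e * f * h₁ + d * e * h₃ - e ^ 2 * h₄
      exact (mul_eq_zero.1 this).resolve_left (mul_ne_zero h2 hne)
    subst ha
    have hd : d ≠ 0 := by rintro rfl; simp at hne
    have he : e ≠ 0 := by rintro rfl; simp at hne
    have hc : c = 0 := by simpa [he] using h₁
    have hb : b = 0 := by simpa [he] using h₃
    subst hc hb
    exact hne (by simpa using h₂)
  have h₂' : a * c + b * f = 0 := by linear_combination h₂ - hdef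
  rcases mul_eq_zero.1 hdef with hde | hf
  · rcases mul_eq_zero.1 hde with hd | he
    · subst hd
      have hce : c * e = 0 := by simpa using h₁
      have hcf : c * f = 0 := by simpa using h₄
      by_cases hc : c = 0
      · subst hc
        have hbf : b * f = 0 := by simpa using h₂'
        rcases mul_eq_zero.1 hbf with h | h <;> subst h <;> simp_all
      · simp_all
    · subst he
      have had : a * d = 0 := by simpa using h₁
      have haf : a * f = 0 := by simpa using h₃
      by_cases ha : a = 0
      · subst ha
        have hbf : b * f = 0 := by simpa using h₂'
        rcases mul_eq_zero.1 hbf with h | h <;> subst h <;> simp_all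
      · simp_all
  · subst hf
    have hac : a * c = 0 := by simpa using h₂'
    rcases mul_eq_zero.1 hac with h | h <;> subst h <;> simp_all

/-- **Example 5 (Barile), char ≠ 2.** In `R = K[x₁,…,x₆]` with `char K ≠ 2`, the ideal
`I = (x₁x₃, x₁x₄, x₁x₆, x₂x₄, x₂x₅, x₂x₆, x₃x₅, x₃x₆, x₄x₅x₆)` satisfies
`I = √(x₁x₄ + x₃x₅, x₁x₃ + x₂x₆ + x₄x₅x₆, x₁x₆ + x₂x₅, x₂x₄ + x₃x₆)`.
(The variables `x₁,…,x₆` are `X 0, …, X 5`.) -/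
theorem example5_char_ne_two (K : Type*) [Field K] (hchar : ringChar K ≠ 2) :
    Ideal.span ({X 0 * X 2, X 0 * X 3, X 0 * X 5, X 1 * X 3, X 1 * X 4, X 1 * X 5,
        X 2 * X 4, X 2 * X 5, X 3 * X 4 * X 5} : Set (MvPolynomial (Fin 6) K)) =
      (Ideal.span ({X 0 * X 3 + X 2 * X 4,
        X 0 * X 2 + X 1 * X 5 + X 3 * X 4 * X 5,
        X 0 * X 5 + X 1 * X 4,
        X 1 * X 3 + X 2 * X 5} : Set (MvPolynomial (Fin 6) K))).radical := by
  have h2K : (2 : K) ≠ 0 := Ring.two_ne_zero hchar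
  apply le_antisymm
  · rw [Ideal.radical_eq_sInf]
    refine le_sInf ?_
    rintro P ⟨hJ, hP⟩
    rw [Ideal.span_le] at hJ ⊢
    have hz : ∀ p : MvPolynomial (Fin 6) K, p ∈ P ↔ Ideal.Quotient.mk P p = 0 :=
      fun p => Ideal.Quotient.eq_zero_iff_mem.symm
    have h2 : (2 : MvPolynomial (Fin 6) K ⧸ P) ≠ 0 := by
      have := (map_ne_zero (algebraMap K (MvPolynomial (Fin 6) K ⧸ P))).2 h2K
      rwa [map_ofNat] at this
    simp only [Set.insert_subset_iff, Set.singleton_subset_iff, SetLike.mem_coe, hz, map_add,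
      map_mul] at hJ ⊢
    obtain ⟨h₁, h₂, h₃, h₄⟩ := hJ
    exact domain_vanish h2 _ _ _ _ _ _ h₁ h₂ h₃ h₄
  · have hrad := squarefree_isRadical (K := K)
      {{0, 2}, {0, 3}, {0, 5}, {1, 3}, {1, 4}, {1, 5}, {2, 4}, {2, 5}, {3, 4, 5}}
    have hset : ((fun T : Finset (Fin 6) => ∏ i ∈ T, (X i : MvPolynomial (Fin 6) K)) ''
        {{0, 2}, {0, 3}, {0, 5}, {1, 3}, {1, 4}, {1, 5}, {2, 4}, {2, 5}, {3, 4, 5}}) =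
        {X 0 * X 2, X 0 * X 3, X 0 * X 5, X 1 * X 3, X 1 * X 4, X 1 * X 5,
        X 2 * X 4, X 2 * X 5, X 3 * X 4 * X 5} := by
      simp [Set.image_insert_eq, Finset.prod_insert, mul_assoc]
    rw [hset] at hrad
    rw [hrad.radical_le_iff, Ideal.span_le]
    simp only [Set.insert_subset_iff, Set.singleton_subset_iff, SetLike.mem_coe]
    refine ⟨?_, ?_, ?_, ?_⟩
    · exact Ideal.add_mem _ (Ideal.subset_span (by simp)) (Ideal.subset_span (by simp))
    · exact Ideal.add_mem _ (Ideal.add_mem _ (Ideal.subset_span (by simp))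
        (Ideal.subset_span (by simp))) (Ideal.subset_span (by simp))
    · exact Ideal.add_mem _ (Ideal.subset_span (by simp)) (Ideal.subset_span (by simp))
    · exact Ideal.add_mem _ (Ideal.subset_span (by simp)) (Ideal.subset_span (by simp))
end

section
/- Let K be an algebraically closed field and R = K[x1,…,x6]. Let I be the ideal of R generated by the monomials x1x3, x1x4, x1x5, x2x4, x2x5, x2x6, x3x5, x3x6, x4x6. Then the arithmetical rank of I equals 4, and I is a set-theoretic complete intersection, i.e., the arithmetical rank of I equals the height of I. -/
open MvPolynomial

/-- The substitution killing the variables in `S`. -/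
noncomputable def hexKill (K : Type*) [Field K] (S : Finset (Fin 6)) :
    MvPolynomial (Fin 6) K →ₐ[K] MvPolynomial (Fin 6) K :=
  aeval fun i => if i ∈ S then 0 else X i

/-- The prime generated by the variables in `S`, as a kernel. -/
noncomputable def hexPrime (K : Type*) [Field K] (S : Finset (Fin 6)) :
    PrimeSpectrum (MvPolynomial (Fin 6) K) :=
  ⟨RingHom.ker (hexKill K S), RingHom.ker_isPrime _⟩

theorem hexKill_X (K : Type*) [Field K] (S : Finset (Fin 6)) (i : Fin 6) :
    hexKill K S (X i) = if i ∈ S then 0 else X i := by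
  simp [hexKill]

theorem hexPrime_le (K : Type*) [Field K] (S : Finset (Fin 6))
    (P : PrimeSpectrum (MvPolynomial (Fin 6) K)) (h : ∀ i ∈ S, X i ∈ P.asIdeal) :
    hexPrime K S ≤ P := by
  intro p hp
  have hp' : hexKill K S p = 0 := hp
  have e : (Ideal.Quotient.mkₐ K P.asIdeal).comp (hexKill K S) =
      Ideal.Quotient.mkₐ K P.asIdeal := by
    apply MvPolynomial.algHom_ext
    intro i
    rw [AlgHom.comp_apply, hexKill_X]
    split_ifs with hi
    · rw [map_zero]
      exact (Ideal.Quotient.eq_zero_iff_mem.mpr (h i hi)).symm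
    · rfl
  have := congrArg (fun g => g p) e
  simp only [AlgHom.comp_apply, hp', map_zero] at this
  exact Ideal.Quotient.eq_zero_iff_mem.mp this.symm

theorem hexPrime_card_le (K : Type*) [Field K] (S : Finset (Fin 6)) :
    (S.card : ℕ∞) ≤ Order.height (hexPrime K S) := by
  induction S using Finset.induction_on with
  | empty => simp
  | insert a S ha ih =>
    rw [Finset.card_insert_of_notMem ha]
    push_cast
    refine le_trans (add_le_add_left ih 1) (Order.height_add_one_le ?_)
    refine lt_of_le_of_ne (hexPrime_le K S _ fun i hi => ?_) fun h => ?_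
    · change hexKill K _ (X i) = 0
      rw [hexKill_X, if_pos (Finset.mem_insert_of_mem hi)]
    · have h1 : X a ∈ (hexPrime K (insert a S)).asIdeal := by
        change hexKill K _ (X a) = 0
        rw [hexKill_X, if_pos (Finset.mem_insert_self _ _)]
      rw [← h] at h1
      have h2 : hexKill K S (X a) = 0 := h1
      rw [hexKill_X, if_neg ha] at h2
      exact X_ne_zero a h2

/-- The ideal of the hexagon. -/
noncomputable def hexI (K : Type*) [Field K] : Ideal (MvPolynomial (Fin 6) K) :=
  Ideal.span {X 0 * X 2, X 0 * X 3, X 0 * X 4, X 1 * X 3, X 1 * X 4, X 1 * X 5,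
          X 2 * X 4, X 2 * X 5, X 3 * X 5}

/-- The four polynomials. -/
noncomputable def hexF (K : Type*) [Field K] : Fin 4 → MvPolynomial (Fin 6) K :=
  ![X 0 * X 3, X 2 * X 5 + X 4 * X 1, X 5 * X 1 + X 0 * (X 2 + X 4),
    X 2 * X 4 + X 3 * (X 5 + X 1)]

theorem hexI_le_iff (K : Type*) [Field K] (P : Ideal (MvPolynomial (Fin 6) K)) :
    hexI K ≤ P ↔ X 0 * X 2 ∈ P ∧ X 0 * X 3 ∈ P ∧ X 0 * X 4 ∈ P ∧ X 1 * X 3 ∈ P ∧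
      X 1 * X 4 ∈ P ∧ X 1 * X 5 ∈ P ∧ X 2 * X 4 ∈ P ∧ X 2 * X 5 ∈ P ∧ X 3 * X 5 ∈ P := by
  rw [hexI, Ideal.span_le]
  simp [Set.insert_subset_iff]

/-- Pure domain computation. -/
theorem hex_domain {A : Type*} [CommRing A] [IsDomain A] (x0 x1 x2 x3 x4 x5 : A)
    (h0 : x0 * x3 = 0) (h1 : x2 * x5 + x4 * x1 = 0) (h2 : x5 * x1 + x0 * (x2 + x4) = 0)
    (h3 : x2 * x4 + x3 * (x5 + x1) = 0) :
    x0 * x2 = 0 ∧ x0 * x3 = 0 ∧ x0 * x4 = 0 ∧ x1 * x3 = 0 ∧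
      x1 * x4 = 0 ∧ x1 * x5 = 0 ∧ x2 * x4 = 0 ∧ x2 * x5 = 0 ∧ x3 * x5 = 0 := by
  rcases mul_eq_zero.mp h0 with rfl | rfl
  · simp only [zero_mul, add_zero, mul_eq_zero] at h2
    rcases h2 with rfl | rfl
    · simp only [mul_zero, zero_add, mul_eq_zero] at h1
      rcases h1 with rfl | rfl <;> simp_all [or_comm]
    · simp only [mul_zero, add_zero, mul_eq_zero] at h1
      rcases h1 with rfl | rfl <;> simp_all [or_comm]
  · simp only [zero_mul, add_zero, mul_eq_zero] at h3
    rcases h3 with rfl | rfl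
    · simp only [zero_mul, zero_add, mul_eq_zero] at h1
      rcases h1 with rfl | rfl <;> simp_all [or_comm]
    · simp only [zero_mul, add_zero, mul_eq_zero] at h1
      rcases h1 with rfl | rfl <;> simp_all [or_comm]

theorem hexF_le_iff (K : Type*) [Field K] (P : Ideal (MvPolynomial (Fin 6) K)) [P.IsPrime] :
    Ideal.span (Set.range (hexF K)) ≤ P ↔ hexI K ≤ P := by
  rw [hexI_le_iff, Ideal.span_le, Set.range_subset_iff]
  simp only [Fin.forall_fin_succ, hexF, SetLike.mem_coe]
  simp only [← Ideal.Quotient.eq_zero_iff_mem]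
  constructor
  · rintro ⟨h0, h1, h2, h3, -⟩
    simp only [map_mul]
    apply hex_domain
    · simpa using h0
    · simpa using h1
    · simpa using h2
    · simpa using h3
  · rintro ⟨h1, h2, h3, h4, h5, h6, h7, h8, h9⟩
    simp only [map_mul] at h1 h2 h3 h4 h5 h6 h7 h8 h9
    refine ⟨?_, ?_, ?_, ?_, fun i => i.elim0⟩ <;> simp
    · simpa using h2
    · linear_combination h8 + h5
    · linear_combination h6 + h1 + h3
    · linear_combination h7 + h9 + h4

theorem hexF_radical (K : Type*) [Field K] :
    (Ideal.span (Set.range (hexF K))).radical = (hexI K).radical := by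
  simp only [Ideal.radical_eq_sInf]
  congr 1
  ext P
  simp only [Set.mem_ofPred_eq]
  constructor
  · rintro ⟨h, hP⟩
    exact ⟨(hexF_le_iff K P).mp h, hP⟩
  · rintro ⟨h, hP⟩
    exact ⟨(hexF_le_iff K P).mpr h, hP⟩

theorem hex_cover (p : Fin 6 → Prop) (h : (p 0 ∨ p 2) ∧ (p 0 ∨ p 3) ∧ (p 0 ∨ p 4) ∧
    (p 1 ∨ p 3) ∧ (p 1 ∨ p 4) ∧ (p 1 ∨ p 5) ∧ (p 2 ∨ p 4) ∧ (p 2 ∨ p 5) ∧ (p 3 ∨ p 5)) :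
    ∃ S : Finset (Fin 6), S.card = 4 ∧ ∀ i ∈ S, p i := by
  have : (p 2 ∧ p 3 ∧ p 4 ∧ p 5) ∨ (p 0 ∧ p 3 ∧ p 4 ∧ p 5) ∨ (p 0 ∧ p 1 ∧ p 4 ∧ p 5) ∨
      (p 0 ∧ p 1 ∧ p 2 ∧ p 5) ∨ (p 0 ∧ p 1 ∧ p 2 ∧ p 3) ∨ (p 1 ∧ p 2 ∧ p 3 ∧ p 4) := by
    generalize p 0 = a at h ⊢
    generalize p 1 = b at h ⊢
    generalize p 2 = c at h ⊢
    generalize p 3 = d at h ⊢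
    generalize p 4 = e at h ⊢
    generalize p 5 = f at h ⊢
    by_cases a <;> by_cases b <;> by_cases c <;> by_cases d <;> simp_all
  rcases this with h | h | h | h | h | h
  · exact ⟨{2, 3, 4, 5}, rfl, by simpa using h⟩
  · exact ⟨{0, 3, 4, 5}, rfl, by simpa using h⟩
  · exact ⟨{0, 1, 4, 5}, rfl, by simpa using h⟩
  · exact ⟨{0, 1, 2, 5}, rfl, by simpa using h⟩
  · exact ⟨{0, 1, 2, 3}, rfl, by simpa using h⟩
  · exact ⟨{1, 2, 3, 4}, rfl, by simpa using h⟩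

theorem hex_four_le (K : Type*) [Field K] (P : PrimeSpectrum (MvPolynomial (Fin 6) K))
    (h : hexI K ≤ P.asIdeal) : (4 : ℕ∞) ≤ Order.height P := by
  rw [hexI_le_iff] at h
  simp only [P.isPrime.mul_mem_iff_mem_or_mem] at h
  obtain ⟨S, hS, hS'⟩ := hex_cover (fun i => X i ∈ P.asIdeal) h
  have := hexPrime_card_le K S
  rw [hS] at this
  exact le_trans this (Order.height_mono (hexPrime_le K S P hS'))

theorem hex_le_of_radical (K : Type*) [Field K] (n : ℕ) (f : Fin n → MvPolynomial (Fin 6) K)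
    (hf : (Ideal.span (Set.range f)).radical = (hexI K).radical)
    (P : PrimeSpectrum (MvPolynomial (Fin 6) K)) (hP : P.asIdeal ∈ (hexI K).minimalPrimes) :
    Order.height P ≤ n := by
  rw [← Ideal.radical_minimalPrimes, ← hf, Ideal.radical_minimalPrimes] at hP
  have h1 := Ideal.height_le_card_of_mem_minimalPrimes_span (Set.finite_range f) hP
  have h2 : (Set.range f).ncard ≤ n := by
    rw [← Set.image_univ]
    refine (Set.ncard_image_le Set.finite_univ).trans ?_
    simp [Set.ncard_univ]
  rw [← PrimeSpectrum.height_eq_orderHeight]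
  exact h1.trans (by exact_mod_cast h2)

theorem hexI_exists_min (K : Type*) [Field K] :
    ∃ P : PrimeSpectrum (MvPolynomial (Fin 6) K), P.asIdeal ∈ (hexI K).minimalPrimes := by
  have hne : hexI K ≠ ⊤ := by
    intro h
    have : hexI K ≤ (hexPrime K Finset.univ).asIdeal := by
      rw [hexI_le_iff]
      have hX : ∀ i, X i ∈ (hexPrime K Finset.univ).asIdeal := fun i => by
        change hexKill K _ (X i) = 0
        rw [hexKill_X, if_pos (Finset.mem_univ _)]
      refine ⟨?_, ?_, ?_, ?_, ?_, ?_, ?_, ?_, ?_⟩ <;> exact Ideal.mul_mem_right _ _ (hX _)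
    rw [h] at this
    exact (hexPrime K Finset.univ).isPrime.ne_top (top_le_iff.mp this)
  obtain ⟨P, hP⟩ := Ideal.nonempty_minimalPrimes hne
  exact ⟨⟨P, hP.1.1⟩, hP⟩

/-- **Example 6 (Barile/Terai).** Let `K` be algebraically closed and `R = K[x₁,…,x₆]`.
The ideal `I = (x₁x₃, x₁x₄, x₁x₅, x₂x₄, x₂x₅, x₂x₆, x₃x₅, x₃x₆, x₄x₆)` has arithmetical
rank `4` (some `4` elements generate an ideal with the same radical as `I`, and no fewer
do so), and `I` is a set-theoretic complete intersection: its arithmetical rank equals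
its height.  (The variables `x₁,…,x₆` are `X 0, …, X 5`.) -/
theorem hexagon_ara_eq_four_and_stci (K : Type*) [Field K] [IsAlgClosed K] :
    (∃ f : Fin 4 → MvPolynomial (Fin 6) K,
      (Ideal.span (Set.range f)).radical =
        (Ideal.span ({X 0 * X 2, X 0 * X 3, X 0 * X 4, X 1 * X 3, X 1 * X 4, X 1 * X 5,
          X 2 * X 4, X 2 * X 5, X 3 * X 5} : Set (MvPolynomial (Fin 6) K))).radical) ∧
    (∀ (n : ℕ) (f : Fin n → MvPolynomial (Fin 6) K),
      (Ideal.span (Set.range f)).radical =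
        (Ideal.span ({X 0 * X 2, X 0 * X 3, X 0 * X 4, X 1 * X 3, X 1 * X 4, X 1 * X 5,
          X 2 * X 4, X 2 * X 5, X 3 * X 5} : Set (MvPolynomial (Fin 6) K))).radical →
        4 ≤ n) ∧
    idealHeight (Ideal.span ({X 0 * X 2, X 0 * X 3, X 0 * X 4, X 1 * X 3, X 1 * X 4,
      X 1 * X 5, X 2 * X 4, X 2 * X 5, X 3 * X 5} : Set (MvPolynomial (Fin 6) K))) =
      (4 : ℕ) := by
  obtain ⟨P, hP⟩ := hexI_exists_min K
  refine ⟨⟨hexF K, hexF_radical K⟩, fun n f hf => ?_, ?_⟩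
  · have := (hex_four_le K P hP.1.2).trans (hex_le_of_radical K n f hf P hP)
    exact_mod_cast this
  · change idealHeight (hexI K) = _
    apply le_antisymm
    · refine le_trans (sInf_le ⟨P.asIdeal, P.isPrime, hP, rfl⟩) ?_
      exact hex_le_of_radical K 4 (hexF K) (hexF_radical K) P hP
    · refine le_sInf ?_
      rintro _ ⟨Q, hQ, hQm, rfl⟩
      exact hex_four_le K ⟨Q, hQ⟩ hQm.1.2
end

section
/- Let K be an algebraically closed field and R = K[x1,…,x8]. Let I be the ideal of R generated by the monomials x1x3, x1x4, x1x6, x1x7, x1x8, x2x4, x2x5, x2x6, x2x7, x2x8, x3x5, x3x6, x3x7, x3x8, x4x6, x4x7, x5x7, x5x8, x6x8. Then I is a set-theoretic complete intersection: the arithmetical rank of I equals the height of I, which is 6. -/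
open MvPolynomial

/-- The ideal of the coordinate subspace where the variables in `s` vanish. -/
noncomputable def coordIdeal (K : Type*) [Field K] (s : Finset (Fin 8)) :
    Ideal (MvPolynomial (Fin 8) K) :=
  RingHom.ker (aeval (fun i => if i ∈ s then 0 else X i) :
    MvPolynomial (Fin 8) K →ₐ[K] MvPolynomial (Fin 8) K)

instance coordIdeal_isPrime (K : Type*) [Field K] (s : Finset (Fin 8)) :
    (coordIdeal K s).IsPrime := RingHom.ker_isPrime _

theorem X_mem_coordIdeal {K : Type*} [Field K] {s : Finset (Fin 8)} {i : Fin 8} :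
    X i ∈ coordIdeal K s ↔ i ∈ s := by
  unfold coordIdeal
  rw [RingHom.mem_ker, aeval_X]
  split_ifs with h <;> simp [h]

theorem coordIdeal_le {K : Type*} [Field K] {s : Finset (Fin 8)}
    {P : Ideal (MvPolynomial (Fin 8) K)} (h : ∀ i ∈ s, X i ∈ P) : coordIdeal K s ≤ P := by
  intro p hp
  have hp' : (aeval (fun i => if i ∈ s then 0 else X i) :
    MvPolynomial (Fin 8) K →ₐ[K] MvPolynomial (Fin 8) K) p = 0 := hp
  have key : (Ideal.Quotient.mkₐ K P).comp (aeval (fun i => if i ∈ s then 0 else X i) :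
      MvPolynomial (Fin 8) K →ₐ[K] MvPolynomial (Fin 8) K) = Ideal.Quotient.mkₐ K P := by
    apply MvPolynomial.algHom_ext
    intro i
    rw [AlgHom.comp_apply, aeval_X]
    split_ifs with hi
    · rw [map_zero]
      exact (Ideal.Quotient.eq_zero_iff_mem.mpr (h i hi)).symm
    · rfl
  have h2 := DFunLike.congr_fun key p
  rw [AlgHom.comp_apply, hp', map_zero] at h2
  exact Ideal.Quotient.eq_zero_iff_mem.mp h2.symm

theorem card_le_height_coordIdeal (K : Type*) [Field K] (s : Finset (Fin 8)) :
    (s.card : ℕ∞) ≤ (coordIdeal K s).height := by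
  induction s using Finset.induction_on with
  | empty => simp
  | insert a s ha ih =>
    have hlt : coordIdeal K s < coordIdeal K (insert a s) := by
      refine lt_of_le_of_ne (coordIdeal_le fun i hi => ?_) fun h => ?_
      · exact X_mem_coordIdeal.mpr (Finset.mem_insert_of_mem hi)
      · apply ha
        rw [← X_mem_coordIdeal (K := K), h]
        exact X_mem_coordIdeal.mpr (Finset.mem_insert_self a s)
    rw [Finset.card_insert_of_notMem ha]
    push_cast
    exact (add_le_add_left ih 1).trans (Ideal.height_add_one_le_of_lt_of_isPrime hlt)

theorem cover_card : ∀ a b c d e f g h : Bool,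
    (a || c) → (a || d) → (a || f) → (a || g) → (a || h) →
    (b || d) → (b || e) → (b || f) → (b || g) → (b || h) →
    (c || e) → (c || f) → (c || g) → (c || h) →
    (d || f) → (d || g) → (e || g) → (e || h) → (f || h) →
    6 ≤ a.toNat + b.toNat + c.toNat + d.toNat + e.toNat + f.toNat + g.toNat + h.toNat := by
  intro a b c d e f g h
  cases a <;> cases b <;> cases c <;> cases d <;> cases e <;> cases f <;> cases g <;> cases h <;> simp

/-- Vanishing of the six polynomials forces all nineteen products to vanish. -/
theorem six_eqs {A : Type*} [CommRing A] [IsDomain A] (a b c d e f g h : A)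
    (h1 : c * f = 0) (h2 : b * g = 0) (h3 : a * g + b * h = 0)
    (h4 : b * d + e * g + a * h = 0)
    (h5 : a * c + b * e + a * f + d * f + a * g + c * g + e * h = 0)
    (h6 : a * d + c * e + b * f + c * g + d * g + c * h + f * h = 0) :
    (a = 0 ∨ c = 0) ∧ (a = 0 ∨ d = 0) ∧ (a = 0 ∨ f = 0) ∧ (a = 0 ∨ g = 0) ∧ (a = 0 ∨ h = 0) ∧
    (b = 0 ∨ d = 0) ∧ (b = 0 ∨ e = 0) ∧ (b = 0 ∨ f = 0) ∧ (b = 0 ∨ g = 0) ∧ (b = 0 ∨ h = 0) ∧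
    (c = 0 ∨ e = 0) ∧ (c = 0 ∨ f = 0) ∧ (c = 0 ∨ g = 0) ∧ (c = 0 ∨ h = 0) ∧
    (d = 0 ∨ f = 0) ∧ (d = 0 ∨ g = 0) ∧ (e = 0 ∨ g = 0) ∧ (e = 0 ∨ h = 0) ∧
    (f = 0 ∨ h = 0) := by
  rw [mul_eq_zero] at h1 h2
  by_cases hb : b = 0 <;> by_cases hc : c = 0 <;> by_cases hf : f = 0 <;> by_cases hg : g = 0 <;>
  by_cases ha : a = 0 <;> by_cases hd : d = 0 <;> by_cases he : e = 0 <;> by_cases hh : h = 0 <;>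
  simp_all

/-- The ideal of the example. -/
noncomputable def exIdeal (K : Type*) [Field K] : Ideal (MvPolynomial (Fin 8) K) :=
  (Ideal.span ({X 0 * X 2, X 0 * X 3, X 0 * X 5, X 0 * X 6, X 0 * X 7,
          X 1 * X 3, X 1 * X 4, X 1 * X 5, X 1 * X 6, X 1 * X 7,
          X 2 * X 4, X 2 * X 5, X 2 * X 6, X 2 * X 7,
          X 3 * X 5, X 3 * X 6, X 4 * X 6, X 4 * X 7, X 5 * X 7} :
          Set (MvPolynomial (Fin 8) K)))

theorem exIdeal_le_iff {K : Type*} [Field K] {P : Ideal (MvPolynomial (Fin 8) K)}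
    (hP : P.IsPrime) : exIdeal K ≤ P ↔
    ((X 0 ∈ P ∨ X 2 ∈ P) ∧ (X 0 ∈ P ∨ X 3 ∈ P) ∧ (X 0 ∈ P ∨ X 5 ∈ P) ∧ (X 0 ∈ P ∨ X 6 ∈ P) ∧
    (X 0 ∈ P ∨ X 7 ∈ P) ∧
    (X 1 ∈ P ∨ X 3 ∈ P) ∧ (X 1 ∈ P ∨ X 4 ∈ P) ∧ (X 1 ∈ P ∨ X 5 ∈ P) ∧ (X 1 ∈ P ∨ X 6 ∈ P) ∧
    (X 1 ∈ P ∨ X 7 ∈ P) ∧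
    (X 2 ∈ P ∨ X 4 ∈ P) ∧ (X 2 ∈ P ∨ X 5 ∈ P) ∧ (X 2 ∈ P ∨ X 6 ∈ P) ∧ (X 2 ∈ P ∨ X 7 ∈ P) ∧
    (X 3 ∈ P ∨ X 5 ∈ P) ∧ (X 3 ∈ P ∨ X 6 ∈ P) ∧ (X 4 ∈ P ∨ X 6 ∈ P) ∧ (X 4 ∈ P ∨ X 7 ∈ P) ∧
    (X 5 ∈ P ∨ X 7 ∈ P)) := by
  unfold exIdeal
  rw [Ideal.span_le]
  simp only [Set.insert_subset_iff, Set.singleton_subset_iff, SetLike.mem_coe, hP.mul_mem_iff_mem_or_mem]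

theorem six_le_height {K : Type*} [Field K] {P : Ideal (MvPolynomial (Fin 8) K)}
    (hP : P.IsPrime) (h : exIdeal K ≤ P) : 6 ≤ P.height := by
  classical
  let s : Finset (Fin 8) := Finset.univ.filter fun i => X i ∈ P
  have hs : 6 ≤ s.card := by
    have h' := (exIdeal_le_iff hP).mp h
    obtain ⟨h1, h2, h3, h4, h5, h6, h7, h8, h9, h10, h11, h12, h13, h14, h15, h16, h17, h18, h19⟩ := h'
    have := cover_card (decide (X 0 ∈ P)) (decide (X 1 ∈ P)) (decide (X 2 ∈ P))
      (decide (X 3 ∈ P)) (decide (X 4 ∈ P)) (decide (X 5 ∈ P)) (decide (X 6 ∈ P))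
      (decide (X 7 ∈ P)) (by simpa using h1) (by simpa using h2) (by simpa using h3)
      (by simpa using h4) (by simpa using h5) (by simpa using h6) (by simpa using h7)
      (by simpa using h8) (by simpa using h9) (by simpa using h10) (by simpa using h11)
      (by simpa using h12) (by simpa using h13) (by simpa using h14) (by simpa using h15)
      (by simpa using h16) (by simpa using h17) (by simpa using h18) (by simpa using h19)
    have hc : s.card = ∑ i : Fin 8, (decide (X i ∈ P)).toNat := by
      rw [Finset.card_filter]
      refine Finset.sum_congr rfl fun i _ => ?_
      by_cases hi : X i ∈ P <;> simp [hi]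
    rw [hc]
    simpa only [Fin.sum_univ_eight] using this
  calc (6 : ℕ∞) ≤ (s.card : ℕ∞) := by exact_mod_cast hs
    _ ≤ (coordIdeal K s).height := card_le_height_coordIdeal K s
    _ ≤ P.height := Ideal.height_mono (coordIdeal_le fun i hi => (Finset.mem_filter.mp hi).2)

/-- The six polynomials. -/
noncomputable def sixPolys (K : Type*) [Field K] : Fin 6 → MvPolynomial (Fin 8) K :=
  ![X 2 * X 5, X 1 * X 6, X 0 * X 6 + X 1 * X 7,
    X 1 * X 3 + X 4 * X 6 + X 0 * X 7,
    X 0 * X 2 + X 1 * X 4 + X 0 * X 5 + X 3 * X 5 + X 0 * X 6 + X 2 * X 6 + X 4 * X 7,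
    X 0 * X 3 + X 2 * X 4 + X 1 * X 5 + X 2 * X 6 + X 3 * X 6 + X 2 * X 7 + X 5 * X 7]

theorem sixPolys_mem (K : Type*) [Field K] (i : Fin 6) : sixPolys K i ∈ exIdeal K := by
  unfold exIdeal
  fin_cases i <;> simp only [sixPolys, Fin.zero_eta, Fin.mk_one, Fin.reduceFinMk, Matrix.cons_val] <;>
    repeat' first
      | apply Ideal.add_mem
      | (apply Ideal.subset_span; simp only [Set.mem_insert_iff, Set.mem_singleton_iff, true_or, or_true])

theorem exIdeal_le_of_sixPolys {K : Type*} [Field K] {P : Ideal (MvPolynomial (Fin 8) K)}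
    (hP : P.IsPrime) (h : Ideal.span (Set.range (sixPolys K)) ≤ P) : exIdeal K ≤ P := by
  rw [exIdeal_le_iff hP]
  have hq : ∀ i, Ideal.Quotient.mk P (sixPolys K i) = 0 := fun i =>
    Ideal.Quotient.eq_zero_iff_mem.mpr (h (Ideal.subset_span ⟨i, rfl⟩))
  have h0 := hq 0
  have h1 := hq 1
  have h2 := hq 2
  have h3 := hq 3
  have h4 := hq 4
  have h5 := hq 5
  simp only [sixPolys, Matrix.cons_val, map_add, map_mul] at h0 h1 h2 h3 h4 h5
  have := six_eqs _ _ _ _ _ _ _ _ h0 h1 h2 h3 h4 h5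
  simpa only [Ideal.Quotient.eq_zero_iff_mem] using this

theorem radical_sixPolys (K : Type*) [Field K] :
    (Ideal.span (Set.range (sixPolys K))).radical = (exIdeal K).radical := by
  apply le_antisymm
  · apply Ideal.radical_mono
    rw [Ideal.span_le]
    rintro _ ⟨i, rfl⟩
    exact sixPolys_mem K i
  · rw [Ideal.radical_le_radical_iff, Ideal.radical_eq_sInf, le_sInf_iff]
    rintro P ⟨h, hP⟩
    exact exIdeal_le_of_sixPolys hP h

theorem exIdeal_ne_top (K : Type*) [Field K] : exIdeal K ≠ ⊤ := by
  intro h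
  have h2 : exIdeal K ≤ coordIdeal K Finset.univ := by
    rw [exIdeal_le_iff inferInstance]
    simp only [X_mem_coordIdeal, Finset.mem_univ, or_self, and_self]
  rw [h, top_le_iff] at h2
  exact (coordIdeal_isPrime K Finset.univ).ne_top h2

theorem height_le_of_radical {K : Type*} [Field K] {n : ℕ} (f : Fin n → MvPolynomial (Fin 8) K)
    (hf : (Ideal.span (Set.range f)).radical = (exIdeal K).radical)
    {P : Ideal (MvPolynomial (Fin 8) K)} (hP : P ∈ (exIdeal K).minimalPrimes) :
    P.height ≤ n := by
  rw [← Ideal.radical_minimalPrimes, ← hf, Ideal.radical_minimalPrimes] at hP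
  refine (Ideal.height_le_card_of_mem_minimalPrimes_span (Set.finite_range f) hP).trans ?_
  rw [← Set.image_univ]
  have := Set.ncard_image_le (f := f) Set.finite_univ
  rw [Set.ncard_univ, Nat.card_fin] at this
  exact_mod_cast this

/-- **Example 10 (Barile).** Let `K` be algebraically closed and `R = K[x₁,…,x₈]`.
The ideal `I` generated by the 19 monomials
`x₁x₃, x₁x₄, x₁x₆, x₁x₇, x₁x₈, x₂x₄, x₂x₅, x₂x₆, x₂x₇, x₂x₈, x₃x₅, x₃x₆, x₃x₇, x₃x₈,
x₄x₆, x₄x₇, x₅x₇, x₅x₈, x₆x₈` is a set-theoretic complete intersection: its arithmetical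
rank equals its height, which is `6`.  (The variables `x₁,…,x₈` are `X 0, …, X 7`.) -/
theorem example10_stci (K : Type*) [Field K] [IsAlgClosed K] :
    (∃ f : Fin 6 → MvPolynomial (Fin 8) K,
      (Ideal.span (Set.range f)).radical =
        (Ideal.span ({X 0 * X 2, X 0 * X 3, X 0 * X 5, X 0 * X 6, X 0 * X 7,
          X 1 * X 3, X 1 * X 4, X 1 * X 5, X 1 * X 6, X 1 * X 7,
          X 2 * X 4, X 2 * X 5, X 2 * X 6, X 2 * X 7,
          X 3 * X 5, X 3 * X 6, X 4 * X 6, X 4 * X 7, X 5 * X 7} :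
          Set (MvPolynomial (Fin 8) K))).radical) ∧
    (∀ (n : ℕ) (f : Fin n → MvPolynomial (Fin 8) K),
      (Ideal.span (Set.range f)).radical =
        (Ideal.span ({X 0 * X 2, X 0 * X 3, X 0 * X 5, X 0 * X 6, X 0 * X 7,
          X 1 * X 3, X 1 * X 4, X 1 * X 5, X 1 * X 6, X 1 * X 7,
          X 2 * X 4, X 2 * X 5, X 2 * X 6, X 2 * X 7,
          X 3 * X 5, X 3 * X 6, X 4 * X 6, X 4 * X 7, X 5 * X 7} :
          Set (MvPolynomial (Fin 8) K))).radical → 6 ≤ n) ∧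
    idealHeight (Ideal.span ({X 0 * X 2, X 0 * X 3, X 0 * X 5, X 0 * X 6, X 0 * X 7,
        X 1 * X 3, X 1 * X 4, X 1 * X 5, X 1 * X 6, X 1 * X 7,
        X 2 * X 4, X 2 * X 5, X 2 * X 6, X 2 * X 7,
        X 3 * X 5, X 3 * X 6, X 4 * X 6, X 4 * X 7, X 5 * X 7} :
        Set (MvPolynomial (Fin 8) K))) = (6 : ℕ) := by
  change (∃ f : Fin 6 → MvPolynomial (Fin 8) K,
      (Ideal.span (Set.range f)).radical = (exIdeal K).radical) ∧
    (∀ (n : ℕ) (f : Fin n → MvPolynomial (Fin 8) K),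
      (Ideal.span (Set.range f)).radical = (exIdeal K).radical → 6 ≤ n) ∧
    idealHeight (exIdeal K) = (6 : ℕ)
  obtain ⟨P, hPm⟩ := Ideal.nonempty_minimalPrimes (exIdeal_ne_top K)
  have hP : P.IsPrime := hPm.1.1
  refine ⟨⟨sixPolys K, radical_sixPolys K⟩, fun n f hf => ?_, le_antisymm ?_ ?_⟩
  · exact_mod_cast (six_le_height hP hPm.1.2).trans (height_le_of_radical f hf hPm)
  · have hle : idealHeight (exIdeal K) ≤
        Order.height (⟨P, hP⟩ : PrimeSpectrum (MvPolynomial (Fin 8) K)) :=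
      sInf_le ⟨P, hP, hPm, rfl⟩
    refine hle.trans ?_
    rw [← PrimeSpectrum.height_eq_orderHeight]
    exact height_le_of_radical _ (radical_sixPolys K) hPm
  · refine le_sInf ?_
    rintro _ ⟨Q, hQ, hQm, rfl⟩
    rw [← PrimeSpectrum.height_eq_orderHeight]
    exact six_le_height hQ hQm.1.2
end
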